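/- For the symmetric random walk, for 0 < α, β < 1 with α ≠ β, setting x_N = ⌊αN⌋ and y_N = ⌊βN⌋, the conditional probability that y_N is visited an odd number of times before exit, given that y_N is visited before exit, converges to 1/2: lim_{N→∞} P_{x_N}(G(y_N) ≡ 1 mod 2 | T_{y_N} < τ_N) = 1/2. -/

import Mathlib

open Filter Topology

/-- Position of the nearest-neighbor walk after the steps `w` (`true` = one step right,
`false` = one step left), started from `x`. -/
def walkPos (x : ℤ) (w : List Bool) : ℤ :=
  x + (w.count true : ℤ) - (w.count false : ℤ)

/-- `w` is the step sequence of a trajectory on `{0, 1, …, N}` started at `x` and run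
exactly until the exit time `τ_N = T_0 ∧ T_N`: all positions strictly before the last
step lie strictly inside `(0, N)`, and the final position is `0` or `N`. -/
def IsExitPath (N : ℕ) (x : ℤ) (w : List Bool) : Prop :=
  (∀ k < w.length, 0 < walkPos x (w.take k) ∧ walkPos x (w.take k) < (N : ℤ)) ∧
    (walkPos x w = 0 ∨ walkPos x w = (N : ℤ))

/-- Probability weight of the step sequence `w` when each step goes right with
probability `p` and left with probability `1 - p`, independently. -/
noncomputable def wt (p : ℝ) (w : List Bool) : ℝ :=
  p ^ w.count true * (1 - p) ^ w.count false

/-- `prob N p x S` is the probability, for the walk on `{0, …, N}` with right-step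
probability `p` started at `x` and stopped at the exit time `τ_N`, that its stopped
trajectory (recorded as the step sequence up to time `τ_N`) satisfies `S`. -/
noncomputable def prob (N : ℕ) (p : ℝ) (x : ℤ) (S : List Bool → Prop) : ℝ :=
  ∑' w : List Bool, Set.indicator {w | IsExitPath N x w ∧ S w} (wt p) w

/-- Expectation of `f` of the stopped trajectory for the walk started at `x`. -/
noncomputable def expect (N : ℕ) (p : ℝ) (x : ℤ) (f : List Bool → ℝ) : ℝ :=
  ∑' w : List Bool, Set.indicator {w | IsExitPath N x w} (fun w => wt p w * f w) w

/-- Probability for the walk whose starting point is uniformly distributed on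
`{0, 1, …, N}`; the event `S` may depend on the starting point. -/
noncomputable def probUniform (N : ℕ) (p : ℝ) (S : ℤ → List Bool → Prop) : ℝ :=
  (∑ x ∈ Finset.range (N + 1), prob N p (x : ℤ) (S (x : ℤ))) / (N + 1)

/-- The set of sites visited by the stopped walk up to time `τ_N` (time `0` included). -/
def rangeSet (x : ℤ) (w : List Bool) : Finset ℤ :=
  (Finset.range (w.length + 1)).image fun k => walkPos x (w.take k)

/-- The range `R_N`: the number of distinct sites visited up to the exit time. -/
def rangeCount (x : ℤ) (w : List Bool) : ℕ := (rangeSet x w).card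

/-- The local time `G(y) = Σ_{k=0}^{τ_N} 1_{X_k = y}` of the stopped trajectory `w`. -/
def localTime (x y : ℤ) (w : List Bool) : ℕ :=
  ((Finset.range (w.length + 1)).filter fun k => walkPos x (w.take k) = y).card

/-- The event `T_y < τ_N`: the walk started at `x` visits `y` at some time
`k ≥ 1` strictly before the end of the stopped trajectory `w`. -/
def hitsBefore (x y : ℤ) (w : List Bool) : Prop :=
  ∃ k, 1 ≤ k ∧ k < w.length ∧ walkPos x (w.take k) = y

theorem hasSum_list_congr {f g : List Bool → ℝ} {a : ℝ} (h : ∀ w, f w = g w) (hg : HasSum g a) :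
    HasSum f a := by
  rw [show f = g from funext h]; exact hg

/-- signed step -/
def stp (b : Bool) : ℤ := if b then 1 else -1

theorem walkPos_cons (x : ℤ) (b : Bool) (w : List Bool) :
    walkPos x (b :: w) = walkPos (x + stp b) w := by
  cases b <;> simp [walkPos, stp, List.count_cons] <;> ring

theorem walkPos_nil (x : ℤ) : walkPos x [] = x := by simp [walkPos]

theorem exit_nil (N : ℕ) (x : ℤ) : IsExitPath N x [] ↔ (x = 0 ∨ x = N) := by
  simp [IsExitPath, walkPos_nil]

theorem exit_cons (N : ℕ) (x : ℤ) (b : Bool) (w : List Bool) :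
    IsExitPath N x (b :: w) ↔ ((0 < x ∧ x < N) ∧ IsExitPath N (x + stp b) w) := by
  unfold IsExitPath
  rw [walkPos_cons, ← and_assoc]
  refine and_congr_left fun _ => ?_
  constructor
  · intro h
    refine ⟨by simpa [walkPos_nil] using h 0 (by simp), fun k hk => ?_⟩
    simpa [walkPos_cons] using h (k + 1) (by simpa using hk)
  · rintro ⟨h0, h⟩ k hk
    cases k with
    | zero => simpa [walkPos_nil] using h0
    | succ k => simpa [walkPos_cons] using h k (by simpa using hk)

theorem wt_cons (b : Bool) (w : List Bool) : wt (1/2) (b :: w) = 1/2 * wt (1/2) w := by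
  cases b <;> simp [wt, List.count_cons, pow_succ] <;> ring

theorem wt_nil : wt (1/2) [] = 1 := by simp [wt]

theorem wt_nonneg (w : List Bool) : 0 ≤ wt (1/2) w := by unfold wt; positivity

theorem lt_nil (x y : ℤ) : localTime x y [] = if x = y then 1 else 0 := by
  unfold localTime
  simp [walkPos_nil, Finset.filter_singleton]
  split_ifs <;> rfl

theorem lt_cons (x y : ℤ) (b : Bool) (w : List Bool) :
    localTime x y (b :: w) = (if x = y then 1 else 0) + localTime (x + stp b) y w := by
  unfold localTime
  rw [Finset.card_filter, Finset.card_filter, List.length_cons, Finset.sum_range_succ', add_comm]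
  simp [walkPos_nil, walkPos_cons]

theorem hasSum_list {f : List Bool → ℝ} {a b : ℝ} (ht : HasSum (fun w => f (true :: w)) a)
    (hf : HasSum (fun w => f (false :: w)) b) : HasSum f (f [] + (a + b)) := by
  let e : Unit ⊕ (List Bool ⊕ List Bool) ≃ List Bool :=
    { toFun := Sum.elim (fun _ => []) (Sum.elim (fun w => true :: w) (fun w => false :: w))
      invFun := fun l => match l with
        | [] => Sum.inl ()
        | true :: w => Sum.inr (Sum.inl w)
        | false :: w => Sum.inr (Sum.inr w)
      left_inv := by rintro (_ | _ | _) <;> rfl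
      right_inv := by
        intro l
        match l with
        | [] => rfl
        | true :: w => rfl
        | false :: w => rfl }
  rw [← e.hasSum_iff]
  refine HasSum.sum ?_ (HasSum.sum ht hf)
  exact hasSum_unique _

open Classical in
theorem trunc_sum (N : ℕ) (n : ℕ) : ∀ x : ℤ, ∃ a ≤ (1:ℝ),
    HasSum (fun w => if IsExitPath N x w ∧ w.length < n then wt (1/2) w else 0) a := by
  induction n with
  | zero => intro x; exact ⟨0, by norm_num, by simpa using hasSum_zero⟩
  | succ n ih =>
    intro x
    by_cases hx : 0 < x ∧ x < N
    · obtain ⟨a, ha, hA⟩ := ih (x + stp true)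
      obtain ⟨b, hb, hB⟩ := ih (x + stp false)
      refine ⟨_, ?_, hasSum_list (a := 1/2 * a) (b := 1/2 * b) ?_ ?_⟩
      · have : ¬ (x = 0 ∨ x = N) := by omega
        simp only [exit_nil, this, false_and, if_false]
        linarith
      · refine (hasSum_list_congr fun w => ?_) (hA.mul_left (1/2))
        by_cases hw : IsExitPath N (x + stp true) w ∧ w.length < n
        · rw [if_pos hw, if_pos ⟨(exit_cons N x _ w).2 ⟨hx, hw.1⟩, by simpa using hw.2⟩, wt_cons]
        · rw [if_neg hw, if_neg (fun h => hw ⟨((exit_cons N x _ w).1 h.1).2, by simpa using h.2⟩),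
            mul_zero]
      · refine (hasSum_list_congr fun w => ?_) (hB.mul_left (1/2))
        by_cases hw : IsExitPath N (x + stp false) w ∧ w.length < n
        · rw [if_pos hw, if_pos ⟨(exit_cons N x _ w).2 ⟨hx, hw.1⟩, by simpa using hw.2⟩, wt_cons]
        · rw [if_neg hw, if_neg (fun h => hw ⟨((exit_cons N x _ w).1 h.1).2, by simpa using h.2⟩),
            mul_zero]
    · refine ⟨_, ?_, hasSum_list (a := 0) (b := 0) ?_ ?_⟩
      · rw [wt_nil]; split_ifs <;> norm_num
      · convert hasSum_zero using 2 with w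
        rw [if_neg (by rw [exit_cons]; tauto)]
      · convert hasSum_zero using 2 with w
        rw [if_neg (by rw [exit_cons]; tauto)]

open Classical in
theorem summ_exit (N : ℕ) (x : ℤ) :
    Summable (fun w => if IsExitPath N x w then wt (1/2) w else 0) := by
  refine summable_of_sum_le (c := 1) (fun w => ?_) (fun u => ?_)
  · dsimp; split_ifs
    · exact wt_nonneg w
    · exact le_rfl
  · obtain ⟨a, ha, hA⟩ := trunc_sum N (u.sup List.length + 1) x
    refine le_trans ?_ ha
    refine le_trans (le_of_eq ?_) (sum_le_hasSum u (fun w _ => ?_) hA)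
    · refine Finset.sum_congr rfl fun w hw => ?_
      have : w.length < u.sup List.length + 1 := Nat.lt_succ_of_le (Finset.le_sup (f := List.length) hw)
      simp [this]
    · split_ifs
      · exact wt_nonneg w
      · exact le_rfl

open Classical in
/-- summand of the generating function of the local time -/
noncomputable def gs (N : ℕ) (y : ℤ) (s : ℝ) (x : ℤ) (w : List Bool) : ℝ :=
  if IsExitPath N x w then wt (1/2) w * s ^ localTime x y w else 0

/-- generating function of the local time -/
noncomputable def H (N : ℕ) (y : ℤ) (s : ℝ) (x : ℤ) : ℝ := ∑' w, gs N y s x w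

theorem summ_gs (N : ℕ) (y : ℤ) (s : ℝ) (hs : |s| ≤ 1) (x : ℤ) : Summable (gs N y s x) := by
  classical
  refine Summable.of_norm_bounded (summ_exit N x) fun w => ?_
  unfold gs
  split_ifs
  · rw [norm_mul, norm_pow, Real.norm_eq_abs, Real.norm_eq_abs, abs_of_nonneg (wt_nonneg w)]
    exact mul_le_of_le_one_right (wt_nonneg w) (pow_le_one₀ (abs_nonneg _) hs)
  · simp

theorem H_step (N : ℕ) (y : ℤ) (s : ℝ) (hs : |s| ≤ 1) (x : ℤ) (hx : 0 < x ∧ x < N) :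
    H N y s x = (if x = y then s else 1) * (1/2 * (H N y s (x + 1) + H N y s (x - 1))) := by
  have key : ∀ b w, gs N y s x (b :: w) =
      ((if x = y then s else 1) * (1/2)) * gs N y s (x + stp b) w := by
    intro b w
    unfold gs
    rw [lt_cons, wt_cons, pow_add]
    by_cases hw : IsExitPath N (x + stp b) w
    · rw [if_pos hw, if_pos ((exit_cons N x b w).2 ⟨hx, hw⟩)]
      split_ifs <;> simp <;> ring
    · rw [if_neg hw, if_neg (fun h => hw ((exit_cons N x b w).1 h).2)]
      simp
  have h := hasSum_list (f := gs N y s x)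
    (by simp only [key]; exact (summ_gs N y s hs (x + stp true)).hasSum.mul_left _)
    (by simp only [key]; exact (summ_gs N y s hs (x + stp false)).hasSum.mul_left _)
  have h0 : gs N y s x [] = 0 := by
    have : ¬ (x = 0 ∨ x = N) := by omega
    simp [gs, exit_nil, this]
  unfold H
  rw [h.tsum_eq, h0]
  simp only [stp]
  simp only [if_true, Bool.false_eq_true, if_false, ← sub_eq_add_neg]
  ring

theorem H_bdry (N : ℕ) (y : ℤ) (hy : 0 < y ∧ y < N) (s : ℝ) (x : ℤ) (hx : x = 0 ∨ x = N) :
    H N y s x = 1 := by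
  have key : ∀ b w, gs N y s x (b :: w) = 0 := by
    intro b w
    have : ¬ (0 < x ∧ x < N) := by omega
    simp [gs, exit_cons, this]
  have h := hasSum_list (f := gs N y s x) (a := 0) (b := 0)
    (by simp only [key]; exact hasSum_zero) (by simp only [key]; exact hasSum_zero)
  have hxy : x ≠ y := by omega
  unfold H
  rw [h.tsum_eq]
  have : wt 2⁻¹ [] = 1 := by simpa using wt_nil
  simp [gs, exit_nil, hx, lt_nil, hxy, this]

/-- discrete harmonic functions are affine -/
theorem harm (f : ℤ → ℝ) (a : ℤ) (n : ℕ)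
    (h : ∀ x, a < x → x < a + n → f x = 1/2 * (f (x+1) + f (x-1))) :
    ∀ k : ℕ, k ≤ n → f (a + k) = f a + k * (f (a+1) - f a) := by
  intro k
  induction k using Nat.strong_induction_on with
  | _ k ih =>
    intro hk
    match k, ih, hk with
    | 0, _, _ => simp
    | 1, _, _ => simp
    | k+2, ih, hk =>
      have h1 := ih k (by omega) (by omega)
      have h2 := ih (k+1) (by omega) (by omega)
      have h3 := h (a + (k+1 : ℕ)) (by push_cast; omega) (by push_cast; omega)
      have e1 : a + ((k+1 : ℕ) : ℤ) + 1 = a + ((k+2 : ℕ) : ℤ) := by push_cast; ring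
      have e2 : a + ((k+1 : ℕ) : ℤ) - 1 = a + (k : ℤ) := by push_cast; ring
      rw [e1, e2] at h3
      push_cast at *
      linarith

theorem harm' (f : ℤ → ℝ) (a b : ℤ)
    (h : ∀ x, a < x → x < b → f x = 1/2 * (f (x+1) + f (x-1))) (x : ℤ) (h1 : a ≤ x) (h2 : x ≤ b) :
    (b - a) * (f x - f a) = (x - a) * (f b - f a) := by
  obtain ⟨n, rfl⟩ := Int.le.dest (h1.trans h2)
  obtain ⟨k, rfl⟩ := Int.le.dest h1
  have A := harm f a n h k (by omega)
  have B := harm f a n h n le_rfl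
  rw [A, B]; push_cast; ring

theorem H_one (N : ℕ) (y : ℤ) (hy : 0 < y ∧ y < N) (x : ℤ) (hx : 0 < x ∧ x < N) :
    H N y 1 x = 1 := by
  have h := harm' (H N y 1) 0 N (fun z h1 h2 => by
    rw [H_step N y 1 (by simp) z ⟨h1, h2⟩]; simp) x hx.1.le hx.2.le
  rw [H_bdry N y hy 1 0 (Or.inl rfl), H_bdry N y hy 1 N (Or.inr rfl)] at h
  have : (N : ℝ) ≠ 0 := by
    have : N ≠ 0 := by omega
    exact_mod_cast this
  simp [this] at h
  linarith

theorem H_left (N : ℕ) (y : ℤ) (hy : 0 < y ∧ y < N) (s : ℝ) (hs : |s| ≤ 1) (x : ℤ) (h0 : 0 ≤ x)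
    (hx : x ≤ y) : y * (1 - H N y s x) = x * (1 - H N y s y) := by
  have h := harm' (H N y s) 0 y (fun z h1 h2 => by
    rw [H_step N y s hs z ⟨h1, by omega⟩, if_neg (by omega), one_mul]) x h0 hx
  rw [H_bdry N y hy s 0 (Or.inl rfl)] at h
  push_cast at h
  linarith

theorem H_right (N : ℕ) (y : ℤ) (hy : 0 < y ∧ y < N) (s : ℝ) (hs : |s| ≤ 1) (x : ℤ) (h0 : y ≤ x)
    (hx : x ≤ N) : (N - y : ℝ) * (1 - H N y s x) = (N - x) * (1 - H N y s y) := by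
  have h := harm' (H N y s) y N (fun z h1 h2 => by
    rw [H_step N y s hs z ⟨by omega, by omega⟩, if_neg (by omega), one_mul]) x h0 hx
  rw [H_bdry N y hy s N (Or.inr rfl)] at h
  push_cast at h
  linarith

theorem H_zero_y (N : ℕ) (y : ℤ) (hy : 0 < y ∧ y < N) : H N y 0 y = 0 := by
  rw [H_step N y 0 (by simp) y hy]; simp

theorem H_neg_y (N : ℕ) (y : ℤ) (hy : 0 < y ∧ y < N) :
    1 - H N y (-1) y = 2 / (2 - (1/2 * (1 / (y:ℝ) + 1 / (N - y : ℝ)))) := by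
  have h := H_step N y (-1) (by simp) y hy
  rw [if_pos rfl] at h
  have hl := H_left N y hy (-1) (by simp) (y - 1) (by omega) (by omega)
  have hr := H_right N y hy (-1) (by simp) (y + 1) (by omega) (by omega)
  have y1 : (1:ℝ) ≤ y := by exact_mod_cast hy.1
  have y2 : (1:ℝ) ≤ N - y := by
    have : (y:ℝ) + 1 ≤ N := by exact_mod_cast hy.2
    linarith
  push_cast at hl hr
  set c := 1 - H N y (-1) y with hc
  set u := H N y (-1) (y-1)
  set v := H N y (-1) (y+1)
  have hc' : H N y (-1) y = 1 - c := by rw [hc]; ring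
  rw [hc'] at h
  have hu : 1 - u = c - c * (1 / (y:ℝ)) := by field_simp; linarith
  have hv : 1 - v = c - c * (1 / (N - y:ℝ)) := by
    have : (N - y : ℝ) ≠ 0 := by linarith
    field_simp; linarith
  have b1 : 1 / (y:ℝ) ≤ 1 := by rw [div_le_one (by linarith)]; exact y1
  have b2 : 1 / (N - y:ℝ) ≤ 1 := by rw [div_le_one (by linarith)]; exact y2
  rw [eq_div_iff (by linarith)]
  linear_combination (-1) * h - 1/2 * hu - 1/2 * hv

theorem hits_iff (N : ℕ) (x y : ℤ) (hy : 0 < y ∧ y < N) (hxy : x ≠ y) (w : List Bool)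
    (hw : IsExitPath N x w) : hitsBefore x y w ↔ localTime x y w ≠ 0 := by
  unfold hitsBefore localTime
  rw [Finset.card_ne_zero]
  constructor
  · rintro ⟨k, _, h2, h3⟩
    exact ⟨k, by simp only [Finset.mem_filter, Finset.mem_range]; exact ⟨by omega, h3⟩⟩
  · rintro ⟨k, hk⟩
    simp only [Finset.mem_filter, Finset.mem_range] at hk
    refine ⟨k, ?_, ?_, hk.2⟩
    · by_contra h
      have : k = 0 := by omega
      subst this
      exact hxy (by simpa [walkPos_nil] using hk.2)
    · by_contra h
      have : k = w.length := by omega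
      subst this
      have h2 := hk.2
      rw [List.take_length] at h2
      have := hw.2
      omega

open Classical in
theorem ind_eq (P : List Bool → Prop) (f : List Bool → ℝ) (w : List Bool) :
    Set.indicator {w | P w} f w = if P w then f w else 0 := by
  by_cases h : P w
  · rw [if_pos h]; exact Set.indicator_of_mem h f
  · rw [if_neg h]; exact Set.indicator_of_notMem h f

theorem prob_hit (N : ℕ) (x y : ℤ) (hy : 0 < y ∧ y < N) (hxy : x ≠ y) :
    prob N (1/2) x (fun w => hitsBefore x y w) = H N y 1 x - H N y 0 x := by
  unfold prob H
  rw [← (summ_gs N y 1 (by simp) x).tsum_sub (summ_gs N y 0 (by simp) x)]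
  refine tsum_congr fun w => ?_
  unfold gs
  rw [ind_eq]
  by_cases hw : IsExitPath N x w
  · simp only [hw, hits_iff N x y hy hxy w hw, true_and, if_true]
    by_cases h0 : localTime x y w = 0 <;> simp [h0]
  · simp [hw]

theorem prob_odd (N : ℕ) (x y : ℤ) (hy : 0 < y ∧ y < N) (hxy : x ≠ y) :
    prob N (1/2) x (fun w => localTime x y w % 2 = 1 ∧ hitsBefore x y w)
      = 1/2 * (H N y 1 x - H N y (-1) x) := by
  unfold prob H
  rw [← (summ_gs N y 1 (by simp) x).tsum_sub (summ_gs N y (-1) (by simp) x), ← tsum_mul_left]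
  refine tsum_congr fun w => ?_
  unfold gs
  rw [ind_eq]
  by_cases hw : IsExitPath N x w
  · simp only [hw, hits_iff N x y hy hxy w hw, true_and, if_true]
    rcases Nat.even_or_odd (localTime x y w) with h | h
    · have h' := Nat.even_iff.1 h
      rw [if_neg (by omega), h.neg_one_pow]; simp
    · have h' := Nat.odd_iff.1 h
      rw [if_pos (by omega), h.neg_one_pow]; simp; ring
  · simp [hw]

theorem ratio_eq (N : ℕ) (x y : ℤ) (hx : 0 < x ∧ x < N) (hy : 0 < y ∧ y < N) (hxy : x ≠ y) :
    prob N (1/2) x (fun w => localTime x y w % 2 = 1 ∧ hitsBefore x y w) /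
      prob N (1/2) x (fun w => hitsBefore x y w)
      = 1 / (2 - (1/2 * (1 / (y:ℝ) + 1 / (N - y : ℝ)))) := by
  rw [prob_odd N x y hy hxy, prob_hit N x y hy hxy, H_one N y hy x hx]
  have x1 : (0:ℝ) < x := by exact_mod_cast hx.1
  have x2 : (0:ℝ) < N - x := by
    have : (x:ℝ) < N := by exact_mod_cast hx.2
    linarith
  have y1 : (0:ℝ) < y := by exact_mod_cast hy.1
  have y2 : (0:ℝ) < N - y := by
    have : (y:ℝ) < N := by exact_mod_cast hy.2
    linarith
  have hn := H_neg_y N y hy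
  have hz := H_zero_y N y hy
  have key : ∃ r : ℝ, r ≠ 0 ∧ ∀ s : ℝ, |s| ≤ 1 → 1 - H N y s x = r * (1 - H N y s y) := by
    rcases le_total x y with h | h
    · refine ⟨x / y, by positivity, fun s hs => ?_⟩
      have := H_left N y hy s hs x hx.1.le h
      field_simp; linarith
    · refine ⟨(N - x) / (N - y), by positivity, fun s hs => ?_⟩
      have := H_right N y hy s hs x h hx.2.le
      rw [div_mul_eq_mul_div, eq_div_iff y2.ne']; linarith
  obtain ⟨r, hr, key⟩ := key
  rw [key 0 (by simp), key (-1) (by simp), hn, hz]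
  rw [sub_zero, mul_one]
  generalize (2 - (1/2 * (1 / (y:ℝ) + 1 / (N - y : ℝ)))) = d
  rw [mul_left_comm, mul_div_cancel_left₀ _ hr]
  ring

theorem floor_ne (α β : ℝ) (h : α < β) : ∀ᶠ N : ℕ in atTop, ⌊α * (N : ℝ)⌋ < ⌊β * (N : ℝ)⌋ := by
  have : Tendsto (fun N : ℕ => (β - α) * (N : ℝ)) atTop atTop :=
    tendsto_natCast_atTop_atTop.const_mul_atTop (by linarith)
  filter_upwards [this.eventually_gt_atTop 1] with N hN
  have h1 := Int.floor_le (α * (N : ℝ))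
  have h2 := Int.lt_floor_add_one (β * (N : ℝ))
  have : ((⌊α * (N : ℝ)⌋ : ℤ) : ℝ) < (⌊β * (N : ℝ)⌋ : ℤ) := by linarith
  exact_mod_cast this

theorem floor_mem (α : ℝ) (h0 : 0 < α) (h1 : α < 1) :
    ∀ᶠ N : ℕ in atTop, 0 < ⌊α * (N : ℝ)⌋ ∧ ⌊α * (N : ℝ)⌋ < N := by
  filter_upwards [floor_ne 0 α h0, floor_ne α 1 h1] with N a b
  simp at a b
  exact ⟨by simpa using a, by simpa using b⟩

/-- Proposition 4.3 (symmetric case): the conditional probability that `⌊βN⌋` is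
visited an odd number of times, given that it is visited before exit, tends to `1/2`. -/
theorem odd_parity_conditional_symmetric (α β : ℝ) (hα0 : 0 < α) (hα1 : α < 1)
    (hβ0 : 0 < β) (hβ1 : β < 1) (hαβ : α ≠ β) :
    Tendsto (fun N : ℕ =>
        prob N (1/2) ⌊α * (N : ℝ)⌋
            (fun w => localTime ⌊α * (N : ℝ)⌋ ⌊β * (N : ℝ)⌋ w % 2 = 1 ∧
              hitsBefore ⌊α * (N : ℝ)⌋ ⌊β * (N : ℝ)⌋ w) /
          prob N (1/2) ⌊α * (N : ℝ)⌋
            (fun w => hitsBefore ⌊α * (N : ℝ)⌋ ⌊β * (N : ℝ)⌋ w))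
      atTop (𝓝 (1/2)) := by
  have hev : ∀ᶠ N : ℕ in atTop, ⌊α * (N : ℝ)⌋ ≠ ⌊β * (N : ℝ)⌋ := by
    rcases lt_or_gt_of_ne hαβ with h | h
    · exact (floor_ne α β h).mono fun N hN => hN.ne
    · exact (floor_ne β α h).mono fun N hN => hN.ne'
  have t1 : Tendsto (fun N : ℕ => ((⌊β * (N : ℝ)⌋ : ℤ) : ℝ)) atTop atTop := by
    have : Tendsto (fun N : ℕ => β * (N : ℝ)) atTop atTop :=
      tendsto_natCast_atTop_atTop.const_mul_atTop hβ0
    exact tendsto_intCast_atTop_atTop.comp (tendsto_floor_atTop.comp this)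
  have t2 : Tendsto (fun N : ℕ => (N : ℝ) - ((⌊β * (N : ℝ)⌋ : ℤ) : ℝ)) atTop atTop := by
    have : Tendsto (fun N : ℕ => (1 - β) * (N : ℝ)) atTop atTop :=
      tendsto_natCast_atTop_atTop.const_mul_atTop (by linarith)
    refine tendsto_atTop_mono (fun N => ?_) this
    have := Int.floor_le (β * (N : ℝ))
    linarith
  have t3 : Tendsto (fun N : ℕ => 1 / (2 - (1/2 * (1 / ((⌊β * (N : ℝ)⌋ : ℤ) : ℝ)
      + 1 / ((N : ℝ) - ((⌊β * (N : ℝ)⌋ : ℤ) : ℝ)))))) atTop (𝓝 (1 / (2 - (1/2 * (0 + 0))))) := by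
    refine Tendsto.div tendsto_const_nhds (tendsto_const_nhds.sub (Tendsto.const_mul _
      (Tendsto.add ?_ ?_))) (by norm_num)
    · simp only [one_div]; exact tendsto_inv_atTop_zero.comp t1
    · simp only [one_div]; exact tendsto_inv_atTop_zero.comp t2
  have e : (1 / (2 - (1/2 * (0 + 0))) : ℝ) = 1/2 := by norm_num
  rw [e] at t3
  refine t3.congr' ?_
  filter_upwards [hev, floor_mem α hα0 hα1, floor_mem β hβ0 hβ1] with N h1 h2 h3
  exact (ratio_eq N _ _ h2 h3 h1).symm
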